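/- For all C, s_2 ≥ 1 there exists K such that the following holds. Suppose n, m, s_1 are positive integers with n = s_2 + s_1·m. Let P be an n-vertex s_1-graph such that for every s_2-element set X ⊆ V(P) there exists a (C·n^{−s_1+1})-spread distribution on the set of perfect matchings of P − X. Suppose μ_2 is a distribution over s_2-element subsets of V(P) such that, for X drawn according to μ_2 and any fixed s_2-set X', one has P[X = X'] ≤ 2·binom(n, s_2)^{−1}. Choose a random 2-graph R on V(P) as follows: first pick an s_2-set X according to μ_2, then choose a perfect matching M of P − X according to a (C·n^{−s_1+1})-spread distribution, and set R = ∂₂(X ∪ M), so that R consists of one clique of size s_2 and m cliques of size s_1. Then for every 2-graph I with v vertices and c ≤ n/2 components such that V(I) ⊆ V(P), one has P[I ⊆ R] ≤ K^v · n^{c−v}. -/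

import Mathlib

/-- `P` is an `s`-uniform hypergraph on vertex set `Fin n`. -/
def IsHG (s n : ℕ) (P : Finset (Finset (Fin n))) : Prop := ∀ e ∈ P, e.card = s

/-- `M` is a perfect matching of the vertex set `S` using edges of `P`. -/
def IsPMOn {n : ℕ} (S : Finset (Fin n)) (P : Finset (Finset (Fin n)))
    (M : Finset (Finset (Fin n))) : Prop :=
  M ⊆ P ∧ (∀ e ∈ M, e ⊆ S) ∧ (∀ e ∈ M, ∀ f ∈ M, e ≠ f → Disjoint e f) ∧
    ∀ v ∈ S, ∃ e ∈ M, v ∈ e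

open Classical in
/-- The probability of the event `Q` for `M` drawn according to `μ`. -/
noncomputable def pmProb {n : ℕ} (μ : Finset (Finset (Fin n)) → ℝ)
    (Q : Finset (Finset (Fin n)) → Prop) : ℝ :=
  ∑ M : Finset (Finset (Fin n)), if Q M then μ M else 0

/-- `μ` is a probability distribution on the perfect matchings of `S` in `P`. -/
def IsPMDist {n : ℕ} (S : Finset (Fin n)) (P : Finset (Finset (Fin n)))
    (μ : Finset (Finset (Fin n)) → ℝ) : Prop :=
  (∀ M, 0 ≤ μ M) ∧ (∀ M, μ M ≠ 0 → IsPMOn S P M) ∧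
    (∑ M : Finset (Finset (Fin n)), μ M) = 1

/-- `μ` is `q`-spread: `P[N ⊆ M] ≤ q^{|N|}` for every set `N` of edges of `P`. -/
def IsSpreadPM {n : ℕ} (P : Finset (Finset (Fin n))) (q : ℝ)
    (μ : Finset (Finset (Fin n)) → ℝ) : Prop :=
  ∀ N : Finset (Finset (Fin n)), N ⊆ P → pmProb μ (fun M => N ⊆ M) ≤ q ^ N.card

open Classical in
/-- The number of components of the `2`-graph `I`. -/
noncomputable def numCompsF {n : ℕ} (I : Finset (Finset (Fin n))) : ℕ :=
  (I.image (fun e => I.filter (fun f =>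
    Relation.ReflTransGen (fun a b => a ∈ I ∧ b ∈ I ∧ ∃ v, v ∈ a ∧ v ∈ b) e f))).card

/-- The vertex set spanned by the edges of `I`. -/
def vertsF {n : ℕ} (I : Finset (Finset (Fin n))) : Finset (Fin n) := I.biUnion id

lemma pmProb_le_sum {n : ℕ} {ι : Type*} {μ : Finset (Finset (Fin n)) → ℝ} (hμ : ∀ M, 0 ≤ μ M)
    (s : Finset ι) (Q : Finset (Finset (Fin n)) → Prop)
    (Q' : ι → Finset (Finset (Fin n)) → Prop)
    (h : ∀ M, μ M ≠ 0 → Q M → ∃ i ∈ s, Q' i M) :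
    pmProb μ Q ≤ ∑ i ∈ s, pmProb μ (Q' i) := by
  classical
  unfold pmProb
  rw [Finset.sum_comm]
  refine Finset.sum_le_sum fun M _ => ?_
  have hnn : ∀ i ∈ s, 0 ≤ (if Q' i M then μ M else 0) := by
    intro i _
    split_ifs
    exacts [hμ M, le_rfl]
  split_ifs with hQ
  · by_cases h0 : μ M = 0
    · rw [h0] at hnn ⊢
      exact Finset.sum_nonneg hnn
    · obtain ⟨i, hi, hi'⟩ := h M h0 hQ
      calc μ M = if Q' i M then μ M else 0 := by rw [if_pos hi']
        _ ≤ _ := Finset.single_le_sum (f := fun i => if Q' i M then μ M else 0) hnn hi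
  · exact Finset.sum_nonneg hnn

lemma pmProb_le_add {n : ℕ} {μ : Finset (Finset (Fin n)) → ℝ} (hμ : ∀ M, 0 ≤ μ M)
    (Q Q₁ Q₂ : Finset (Finset (Fin n)) → Prop) (h : ∀ M, Q M → Q₁ M ∨ Q₂ M) :
    pmProb μ Q ≤ pmProb μ Q₁ + pmProb μ Q₂ := by
  have := pmProb_le_sum hμ (Finset.univ : Finset Bool) Q (fun b => if b then Q₁ else Q₂) (by
    intro M _ hQ
    rcases h M hQ with h | h
    · exact ⟨true, Finset.mem_univ _, by simpa using h⟩
    · exact ⟨false, Finset.mem_univ _, by simpa using h⟩)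
  simpa using this

lemma card_filter_superset_le_choose {n s : ℕ} (P : Finset (Finset (Fin n))) (hP : IsHG s n P)
    (b : Finset (Fin n)) :
    (P.filter (fun e => b ⊆ e)).card ≤ (n - b.card).choose (s - b.card) := by
  have hc : bᶜ.card = n - b.card := by rw [Finset.card_compl, Fintype.card_fin]
  rw [← hc, ← Finset.card_powersetCard]
  refine Finset.card_le_card_of_injOn (fun e => e \ b) ?_ ?_
  · intro e he
    simp only [Finset.coe_filter, Set.mem_ofPred_eq] at he
    simp only [Finset.mem_coe, Finset.mem_powersetCard]
    refine ⟨fun x hx => ?_, ?_⟩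
    · rw [Finset.mem_compl]
      exact (Finset.mem_sdiff.1 hx).2
    · rw [Finset.card_sdiff_of_subset he.2, hP e he.1]
  · intro e he f hf hef
    simp only [Finset.coe_filter, Set.mem_ofPred_eq] at he hf
    simp only at hef
    rw [← Finset.sdiff_union_of_subset he.2, hef, Finset.sdiff_union_of_subset hf.2]

lemma filter_superset_eq_empty {n s : ℕ} (P : Finset (Finset (Fin n))) (hP : IsHG s n P)
    (b : Finset (Fin n)) (hb : s < b.card) : P.filter (fun e => b ⊆ e) = ∅ := by
  refine Finset.filter_eq_empty_iff.2 fun e he hbe => ?_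
  have h₁ := Finset.card_le_card hbe
  have h₂ := hP e he
  omega

lemma card_filter_superset_le_zpow {n s : ℕ} (hn : 0 < n) (P : Finset (Finset (Fin n)))
    (hP : IsHG s n P) (b : Finset (Fin n)) :
    ((P.filter (fun e => b ⊆ e)).card : ℝ) ≤ (n : ℝ) ^ ((s : ℤ) - (b.card : ℤ)) := by
  rcases le_or_gt b.card s with hb | hb
  · rw [← Nat.cast_sub hb, zpow_natCast]
    exact_mod_cast (card_filter_superset_le_choose P hP b).trans
      ((Nat.choose_le_pow _ _).trans (Nat.pow_le_pow_left (Nat.sub_le _ _) _))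
  · rw [filter_superset_eq_empty P hP b hb]
    simp only [Finset.card_empty, Nat.cast_zero]
    positivity

lemma pmProb_exists_injective_le {n s : ℕ} (hn : 0 < n) {C : ℝ} (hC : 1 ≤ C)
    {P : Finset (Finset (Fin n))} (hP : IsHG s n P) {S : Finset (Fin n)}
    {μ : Finset (Finset (Fin n)) → ℝ} (hμ : IsPMDist S P μ)
    (hsp : IsSpreadPM P (C * (n : ℝ) ^ ((1 : ℤ) - (s : ℤ))) μ)
    {k : ℕ} (B : Fin k → Finset (Fin n)) :
    pmProb μ (fun M => ∃ f : Fin k → Finset (Fin n), Function.Injective f ∧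
      ∀ j, f j ∈ M ∧ B j ⊆ f j) ≤ ∏ j, (C * (n : ℝ) ^ ((1 : ℤ) - ((B j).card : ℤ))) := by
  classical
  have hn' : (n : ℝ) ≠ 0 := by positivity
  set q := C * (n : ℝ) ^ ((1 : ℤ) - (s : ℤ)) with hq
  have hq0 : 0 ≤ q := by positivity
  set F := (Fintype.piFinset fun j => P.filter (fun e => B j ⊆ e)).filter Function.Injective
    with hF
  calc _ ≤ ∑ f ∈ F, pmProb μ (fun M => Finset.univ.image f ⊆ M) := by
        refine pmProb_le_sum hμ.1 _ _ _ fun M hM ⟨f, hf, hfM⟩ => ⟨f, ?_, ?_⟩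
        · simp only [hF, Finset.mem_filter, Fintype.mem_piFinset]
          exact ⟨fun j => ⟨(hμ.2.1 M hM).1 (hfM j).1, (hfM j).2⟩, hf⟩
        · intro e he
          obtain ⟨j, _, rfl⟩ := Finset.mem_image.1 he
          exact (hfM j).1
    _ ≤ ∑ f ∈ F, q ^ k := by
        refine Finset.sum_le_sum fun f hf => ?_
        simp only [hF, Finset.mem_filter, Fintype.mem_piFinset] at hf
        refine (hsp _ ?_).trans_eq ?_
        · intro e he
          obtain ⟨j, _, rfl⟩ := Finset.mem_image.1 he
          exact (hf.1 j).1
        · rw [Finset.card_image_of_injective _ hf.2, Finset.card_univ, Fintype.card_fin]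
    _ = (F.card : ℝ) * q ^ k := by rw [Finset.sum_const, nsmul_eq_mul]
    _ ≤ (∏ j, (n : ℝ) ^ ((s : ℤ) - ((B j).card : ℤ))) * q ^ k := by
        refine mul_le_mul_of_nonneg_right ?_ (by positivity)
        calc (F.card : ℝ)
            ≤ ((Fintype.piFinset fun j => P.filter (fun e => B j ⊆ e)).card : ℝ) := by
              exact_mod_cast Finset.card_filter_le _ _
          _ = ∏ j, ((P.filter (fun e => B j ⊆ e)).card : ℝ) := by
              rw [Fintype.card_piFinset, Nat.cast_prod]
          _ ≤ _ := Finset.prod_le_prod (fun _ _ => by positivity)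
              fun j _ => card_filter_superset_le_zpow hn P hP (B j)
    _ = ∏ j, ((n : ℝ) ^ ((s : ℤ) - ((B j).card : ℤ)) * q) := by
        rw [Finset.prod_mul_distrib, Finset.prod_const, Finset.card_univ, Fintype.card_fin]
    _ = _ := by
        refine Finset.prod_congr rfl fun j _ => ?_
        rw [hq, mul_left_comm, ← zpow_add₀ hn']
        congr 2
        ring

/-- Given blocks `B j` lying in distinct edges of a spread matching, the disjoint sets `W i` are
covered one at a time: each is either merged into a block or becomes a block of its own. -/
lemma pmProb_cover_le {n s : ℕ} (hn : 0 < n) {C : ℝ} (hC : 1 ≤ C)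
    {P : Finset (Finset (Fin n))} (hP : IsHG s n P) {S : Finset (Fin n)}
    {μ : Finset (Finset (Fin n)) → ℝ} (hμ : IsPMDist S P μ)
    (hsp : IsSpreadPM P (C * (n : ℝ) ^ ((1 : ℤ) - (s : ℤ))) μ)
    {ι : Type*} (W : ι → Finset (Fin n)) (t : Finset ι) :
    (∀ i ∈ t, ∀ j ∈ t, i ≠ j → Disjoint (W i) (W j)) →
    ∀ {k : ℕ} (B : Fin k → Finset (Fin n)), (∀ i ∈ t, ∀ j, Disjoint (B j) (W i)) →
    k + t.card ≤ n →
    pmProb μ (fun M => (∃ f : Fin k → Finset (Fin n), Function.Injective f ∧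
      ∀ j, f j ∈ M ∧ B j ⊆ f j) ∧ ∀ i ∈ t, ∃ e ∈ M, W i ⊆ e) ≤
      (∏ j, (C * (n : ℝ) ^ ((1 : ℤ) - ((B j).card : ℤ)))) *
        ∏ i ∈ t, (2 * C * (n : ℝ) ^ ((1 : ℤ) - ((W i).card : ℤ))) := by
  classical
  have hn' : (n : ℝ) ≠ 0 := by positivity
  induction t using Finset.induction_on with
  | empty =>
    intro _ k B _ _
    simpa using pmProb_exists_injective_le hn hC hP hμ hsp B
  | insert a t ha ih =>
    intro hW k B hB hk
    rw [Finset.card_insert_of_notMem ha] at hk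
    have hW' : ∀ i ∈ t, ∀ j ∈ t, i ≠ j → Disjoint (W i) (W j) := fun i hi j hj =>
      hW i (Finset.mem_insert_of_mem hi) j (Finset.mem_insert_of_mem hj)
    have haW : ∀ i ∈ t, Disjoint (W a) (W i) := fun i hi =>
      hW a (Finset.mem_insert_self _ _) i (Finset.mem_insert_of_mem hi)
        (fun h => ha (h ▸ hi))
    have hB' : ∀ i ∈ t, ∀ j, Disjoint (B j) (W i) := fun i hi =>
      hB i (Finset.mem_insert_of_mem hi)
    have haB := hB a (Finset.mem_insert_self _ _)
    have h₁ := ih hW' (Fin.cons (W a) B : Fin (k + 1) → Finset (Fin n))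
      (fun i hi j => by
        refine Fin.cases ?_ (fun j => ?_) j
        · simpa using haW i hi
        · simpa using hB' i hi j)
      (by omega)
    have h₂ := fun j : Fin k => ih hW' (Function.update B j (B j ∪ W a))
      (fun i hi j' => by
        by_cases hj : j' = j
        · subst hj
          rw [Function.update_self, Finset.disjoint_union_left]
          exact ⟨hB' i hi _, haW i hi⟩
        · rw [Function.update_of_ne hj]
          exact hB' i hi _)
      (by omega)
    rw [Fin.prod_univ_succ] at h₁
    simp only [Fin.cons_zero, Fin.cons_succ] at h₁
    have hupd : ∀ j : Fin k,
        (∏ j', (C * (n : ℝ) ^ ((1 : ℤ) -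
          ((Function.update B j (B j ∪ W a) j').card : ℤ)))) =
        (∏ j', (C * (n : ℝ) ^ ((1 : ℤ) - ((B j').card : ℤ)))) *
          (n : ℝ) ^ (-((W a).card : ℤ)) := by
      intro j
      rw [← Finset.mul_prod_erase _ _ (Finset.mem_univ j),
        ← Finset.mul_prod_erase (Finset.univ) (fun j' => C * (n : ℝ) ^ ((1 : ℤ) -
          ((B j').card : ℤ))) (Finset.mem_univ j), Function.update_self,
        Finset.card_union_of_disjoint (haB j)]
      have : (n : ℝ) ^ ((1 : ℤ) - (((B j).card + (W a).card : ℕ) : ℤ)) =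
          (n : ℝ) ^ ((1 : ℤ) - ((B j).card : ℤ)) * (n : ℝ) ^ (-((W a).card : ℤ)) := by
        rw [← zpow_add₀ hn']
        congr 1
        push_cast
        ring
      rw [this, Finset.prod_congr rfl (g := fun j' => C * (n : ℝ) ^ ((1 : ℤ) -
          ((B j').card : ℤ))) (fun j' hj' => by
            rw [Function.update_of_ne (Finset.ne_of_mem_erase hj')])]
      ring
    simp only [hupd] at h₂
    set β := ∏ j', (C * (n : ℝ) ^ ((1 : ℤ) - ((B j').card : ℤ))) with hβ
    set τ := ∏ i ∈ t, (2 * C * (n : ℝ) ^ ((1 : ℤ) - ((W i).card : ℤ))) with hτ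
    have hβ0 : 0 ≤ β := Finset.prod_nonneg fun _ _ => by positivity
    have hτ0 : 0 ≤ τ := Finset.prod_nonneg fun _ _ => by positivity
    rw [Finset.prod_insert ha, ← hτ]
    have hstep := (pmProb_le_add hμ.1
      (fun M => (∃ f : Fin k → Finset (Fin n), Function.Injective f ∧
        ∀ j, f j ∈ M ∧ B j ⊆ f j) ∧ ∀ i ∈ insert a t, ∃ e ∈ M, W i ⊆ e)
      (fun M => (∃ f : Fin (k + 1) → Finset (Fin n), Function.Injective f ∧
        ∀ j, f j ∈ M ∧ (Fin.cons (W a) B : Fin (k + 1) → Finset (Fin n)) j ⊆ f j) ∧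
          ∀ i ∈ t, ∃ e ∈ M, W i ⊆ e)
      (fun M => ∃ j ∈ Finset.univ, (∃ f : Fin k → Finset (Fin n), Function.Injective f ∧
        ∀ j', f j' ∈ M ∧ Function.update B j (B j ∪ W a) j' ⊆ f j') ∧
          ∀ i ∈ t, ∃ e ∈ M, W i ⊆ e)
      (by
        rintro M ⟨⟨f, hf, hfM⟩, hM⟩
        have hMt : ∀ i ∈ t, ∃ e ∈ M, W i ⊆ e := fun i hi => hM i (Finset.mem_insert_of_mem hi)
        obtain ⟨e, heM, hae⟩ := hM a (Finset.mem_insert_self _ _)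
        by_cases he : e ∈ Set.range f
        · obtain ⟨j, rfl⟩ := he
          refine Or.inr ⟨j, Finset.mem_univ _, ⟨f, hf, fun j' => ⟨(hfM j').1, ?_⟩⟩, hMt⟩
          by_cases hj : j' = j
          · subst hj
            rw [Function.update_self]
            exact Finset.union_subset (hfM _).2 hae
          · rw [Function.update_of_ne hj]
            exact (hfM _).2
        · refine Or.inl ⟨⟨Fin.cons e f, Fin.cons_injective_iff.2 ⟨he, hf⟩, fun j => ?_⟩, hMt⟩
          refine Fin.cases ?_ (fun j => ?_) j
          · simpa using ⟨heM, hae⟩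
          · simpa using hfM j)).trans
      (add_le_add h₁ ((pmProb_le_sum hμ.1 Finset.univ _ _ fun M _ h => h).trans
        (Finset.sum_le_sum fun j _ => h₂ j)))
    refine hstep.trans ?_
    rw [Finset.sum_const, Finset.card_univ, Fintype.card_fin, nsmul_eq_mul, sub_eq_add_neg,
      zpow_add₀ hn', zpow_one]
    set ω := (n : ℝ) ^ (-((W a).card : ℤ)) with hω
    have hω0 : 0 ≤ ω := by positivity
    have hkn : (k : ℝ) ≤ C * n := by
      have : (k : ℝ) ≤ n := by exact_mod_cast (by omega : k ≤ n)
      nlinarith [Nat.cast_nonneg (α := ℝ) n]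
    have := mul_le_mul_of_nonneg_right hkn (mul_nonneg (mul_nonneg hβ0 hω0) hτ0)
    linarith

lemma choose_mul_pow_le {k n : ℕ} (hkn : k ≤ n) (a : ℕ) :
    k.choose a * n ^ a ≤ n.choose a * k ^ a := by
  induction a with
  | zero => simp
  | succ a ih =>
    refine Nat.le_of_mul_le_mul_right ?_ (Nat.succ_pos a)
    have hk := Nat.choose_succ_right_eq k a
    have hn := Nat.choose_succ_right_eq n a
    have hs : (k - a) * n ≤ (n - a) * k := by
      rcases le_total k a with h | h
      · simp [Nat.sub_eq_zero_of_le h]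
      · obtain ⟨c, rfl⟩ := Nat.exists_eq_add_of_le h
        obtain ⟨d, rfl⟩ := Nat.exists_eq_add_of_le hkn
        rw [Nat.add_sub_cancel_left, show a + c + d - a = c + d by omega]
        nlinarith [Nat.zero_le (d * a)]
    calc k.choose (a + 1) * n ^ (a + 1) * (a + 1)
        = (k.choose (a + 1) * (a + 1)) * (n ^ a * n) := by ring
      _ = (k.choose a * n ^ a) * ((k - a) * n) := by rw [hk]; ring
      _ ≤ (n.choose a * k ^ a) * ((n - a) * k) := Nat.mul_le_mul ih hs
      _ = (n.choose (a + 1) * (a + 1)) * (k ^ a * k) := by rw [hn]; ring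
      _ = n.choose (a + 1) * k ^ (a + 1) * (a + 1) := by ring

lemma sum_superset_le {n k : ℕ} (hn : 0 < n) (hkn : k ≤ n) {μ : Finset (Fin n) → ℝ}
    (hμ : ∀ X, μ X ≠ 0 → X.card = k) (hμ1 : ∑ X, μ X = 1)
    (hμ' : ∀ X, X.card = k → μ X ≤ 2 / ((n.choose k : ℕ) : ℝ)) (U : Finset (Fin n)) :
    ∑ X, (if U ⊆ X then μ X else 0) ≤ (2 * k / n : ℝ) ^ U.card := by
  classical
  have hn' : (0 : ℝ) < n := by exact_mod_cast hn
  rcases Nat.eq_zero_or_pos U.card with h0 | hpos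
  · rw [Finset.card_eq_zero] at h0
    simp [h0, hμ1]
  have hc : (0 : ℝ) < (n.choose k : ℕ) := by exact_mod_cast Nat.choose_pos hkn
  have hsum : ∑ X, (if U ⊆ X then μ X else 0) =
      ∑ X ∈ (Finset.powersetCard k Finset.univ).filter (fun X => U ⊆ X), μ X := by
    rw [← Finset.sum_filter]
    symm
    refine Finset.sum_subset (fun X hX => ?_) fun X hX hX' => ?_
    · exact Finset.mem_filter.2 ⟨Finset.mem_univ _, (Finset.mem_filter.1 hX).2⟩
    · by_contra hne
      exact hX' (Finset.mem_filter.2 ⟨Finset.mem_powersetCard.2 ⟨Finset.subset_univ _, hμ X hne⟩,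
        (Finset.mem_filter.1 hX).2⟩)
  have hHG : IsHG k n (Finset.powersetCard k Finset.univ) := fun e he =>
    (Finset.mem_powersetCard.1 he).2
  rw [hsum]
  rcases lt_or_ge k U.card with hU | hU
  · rw [filter_superset_eq_empty _ hHG U hU, Finset.sum_empty]
    positivity
  have hcard := card_filter_superset_le_choose _ hHG U
  have hnat : (n - U.card).choose (k - U.card) * n ^ U.card ≤ n.choose k * k ^ U.card := by
    have hUn : 0 < n.choose U.card := Nat.choose_pos (hU.trans hkn)
    refine Nat.le_of_mul_le_mul_left ?_ hUn
    calc n.choose U.card * ((n - U.card).choose (k - U.card) * n ^ U.card)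
        = (n.choose k * k.choose U.card) * n ^ U.card := by
          rw [Nat.choose_mul hU]; ring
      _ = n.choose k * (k.choose U.card * n ^ U.card) := by ring
      _ ≤ n.choose k * (n.choose U.card * k ^ U.card) :=
          Nat.mul_le_mul_left _ (choose_mul_pow_le hkn _)
      _ = _ := by ring
  have hreal : ((n - U.card).choose (k - U.card) : ℝ) * n ^ U.card ≤
      n.choose k * k ^ U.card := by exact_mod_cast hnat
  calc ∑ X ∈ (Finset.powersetCard k Finset.univ).filter (fun X => U ⊆ X), μ X
      ≤ ∑ X ∈ (Finset.powersetCard k Finset.univ).filter (fun X => U ⊆ X),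
          2 / ((n.choose k : ℕ) : ℝ) := Finset.sum_le_sum fun X hX =>
        hμ' X (Finset.mem_powersetCard.1 (Finset.mem_filter.1 hX).1).2
    _ ≤ ((n - U.card).choose (k - U.card) : ℝ) * (2 / ((n.choose k : ℕ) : ℝ)) := by
        rw [Finset.sum_const, nsmul_eq_mul]
        exact mul_le_mul_of_nonneg_right (by exact_mod_cast hcard) (by positivity)
    _ ≤ 2 * ((k : ℝ) ^ U.card / n ^ U.card) := by
        rw [mul_div_assoc', mul_div_assoc', div_le_div_iff₀ hc (by positivity)]
        nlinarith
    _ ≤ 2 ^ U.card * ((k : ℝ) ^ U.card / n ^ U.card) := by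
        refine mul_le_mul_of_nonneg_right ?_ (by positivity)
        calc (2 : ℝ) = 2 ^ 1 := by norm_num
          _ ≤ 2 ^ U.card := pow_le_pow_right₀ (by norm_num) hpos
    _ = _ := by rw [mul_div_assoc, mul_pow, div_pow]

lemma prod_zpow_eq_zpow_sum {ι K : Type*} [Field K] (t : Finset ι) {a : K} (ha : a ≠ 0)
    (f : ι → ℤ) : ∏ i ∈ t, a ^ f i = a ^ ∑ i ∈ t, f i := by
  classical
  induction t using Finset.induction_on with
  | empty => simp
  | insert i t hi ih => rw [Finset.prod_insert hi, Finset.sum_insert hi, ih, zpow_add₀ ha]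

/-- The spread bound for disjoint nonempty sets, each required to lie inside `X` or inside an
edge of the matching. -/
lemma sum_mul_pmProb_cover_le {C : ℝ} (hC : 1 ≤ C) {s₂ n s₁ : ℕ} (hs₂ : 1 ≤ s₂) (hsn : s₂ ≤ n)
    {P : Finset (Finset (Fin n))} (hP : IsHG s₁ n P)
    {ν : Finset (Fin n) → Finset (Finset (Fin n)) → ℝ}
    (hν : ∀ X : Finset (Fin n), X.card = s₂ →
      IsPMDist (Finset.univ \ X) P (ν X) ∧
      IsSpreadPM P (C * (n : ℝ) ^ ((1 : ℤ) - (s₁ : ℤ))) (ν X))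
    {μ₂ : Finset (Fin n) → ℝ} (hμ0 : ∀ X, 0 ≤ μ₂ X) (hμ : ∀ X, μ₂ X ≠ 0 → X.card = s₂)
    (hμ1 : ∑ X, μ₂ X = 1)
    (hμ' : ∀ X, X.card = s₂ → μ₂ X ≤ 2 / ((n.choose s₂ : ℕ) : ℝ))
    {ι : Type*} (W : ι → Finset (Fin n)) (t : Finset ι)
    (hW : ∀ i ∈ t, ∀ j ∈ t, i ≠ j → Disjoint (W i) (W j)) (hW0 : ∀ i ∈ t, (W i).Nonempty)
    (ht : t.card ≤ n) :
    ∑ X, μ₂ X * pmProb (ν X) (fun M => ∀ i ∈ t, W i ⊆ X ∨ ∃ e ∈ M, W i ⊆ e) ≤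
      (2 * s₂ + 2 * C) ^ (t.biUnion W).card *
        (n : ℝ) ^ ((t.card : ℤ) - ((t.biUnion W).card : ℤ)) := by
  classical
  have hn : 0 < n := by omega
  have hn' : (n : ℝ) ≠ 0 := by positivity
  have hn1 : (1 : ℝ) ≤ n := by exact_mod_cast hn
  let x : ι → ℝ := fun i => (2 * s₂ / n : ℝ) ^ (W i).card
  let y : ι → ℝ := fun i => 2 * C * (n : ℝ) ^ ((1 : ℤ) - ((W i).card : ℤ))
  have hy0 : ∀ i, 0 ≤ y i := fun i => by positivity
  have hpt : ∀ X, μ₂ X * pmProb (ν X) (fun M => ∀ i ∈ t, W i ⊆ X ∨ ∃ e ∈ M, W i ⊆ e) ≤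
      ∑ A ∈ t.powerset, (if A.biUnion W ⊆ X then μ₂ X else 0) * ∏ i ∈ t \ A, y i := by
    intro X
    by_cases h0 : μ₂ X = 0
    · simp [h0]
    obtain ⟨hdist, hspread⟩ := hν X (hμ X h0)
    have hA : ∀ A ∈ t.powerset, pmProb (ν X) (fun M => ∀ i ∈ t \ A, ∃ e ∈ M, W i ⊆ e) ≤
        ∏ i ∈ t \ A, y i := by
      intro A _
      have := pmProb_cover_le hn hC hP hdist hspread W (t \ A)
        (fun i hi j hj => hW i (Finset.sdiff_subset hi) j (Finset.sdiff_subset hj))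
        (Fin.elim0 : Fin 0 → Finset (Fin n)) (fun _ _ j => j.elim0)
        (by have := Finset.card_le_card (Finset.sdiff_subset (s := t) (t := A)); omega)
      rw [Finset.univ_eq_empty, Finset.prod_empty, one_mul] at this
      refine le_trans (le_of_eq ?_) this
      congr 1
      funext M
      refine propext ⟨fun h => ⟨⟨Fin.elim0, fun j => j.elim0, fun j => j.elim0⟩, h⟩, fun h => h.2⟩
    have hunion : pmProb (ν X) (fun M => ∀ i ∈ t, W i ⊆ X ∨ ∃ e ∈ M, W i ⊆ e) ≤
        ∑ A ∈ t.powerset.filter (fun A => A.biUnion W ⊆ X),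
          pmProb (ν X) (fun M => ∀ i ∈ t \ A, ∃ e ∈ M, W i ⊆ e) := by
      refine pmProb_le_sum hdist.1 _ _ _ fun M _ h => ⟨t.filter (fun i => W i ⊆ X), ?_, ?_⟩
      · refine Finset.mem_filter.2 ⟨Finset.mem_powerset.2 (Finset.filter_subset _ _), ?_⟩
        exact Finset.biUnion_subset.2 fun i hi => (Finset.mem_filter.1 hi).2
      · intro i hi
        rw [Finset.mem_sdiff, Finset.mem_filter, not_and] at hi
        exact (h i hi.1).resolve_left (hi.2 hi.1)
    calc _ ≤ μ₂ X * ∑ A ∈ t.powerset.filter (fun A => A.biUnion W ⊆ X), ∏ i ∈ t \ A, y i :=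
          mul_le_mul_of_nonneg_left (hunion.trans (Finset.sum_le_sum fun A hA' =>
            hA A (Finset.mem_filter.1 hA').1)) (hμ0 X)
      _ = _ := by
          rw [Finset.sum_filter, Finset.mul_sum]
          refine Finset.sum_congr rfl fun A _ => ?_
          split_ifs <;> simp
  have hdisj : ∀ A ⊆ t, (A.biUnion W).card = ∑ i ∈ A, (W i).card := fun A hA =>
    Finset.card_biUnion fun i hi j hj hij => hW i (hA hi) j (hA hj) hij
  calc _ ≤ ∑ X, ∑ A ∈ t.powerset,
        (if A.biUnion W ⊆ X then μ₂ X else 0) * ∏ i ∈ t \ A, y i :=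
        Finset.sum_le_sum fun X _ => hpt X
    _ = ∑ A ∈ t.powerset,
        (∑ X, if A.biUnion W ⊆ X then μ₂ X else 0) * ∏ i ∈ t \ A, y i := by
        rw [Finset.sum_comm]
        exact Finset.sum_congr rfl fun A _ => (Finset.sum_mul _ _ _).symm
    _ ≤ ∑ A ∈ t.powerset, (∏ i ∈ A, x i) * ∏ i ∈ t \ A, y i := by
        refine Finset.sum_le_sum fun A hA => mul_le_mul_of_nonneg_right ?_
          (Finset.prod_nonneg fun i _ => hy0 i)
        refine (sum_superset_le hn hsn hμ hμ1 hμ' _).trans_eq ?_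
        rw [hdisj A (Finset.mem_powerset.1 hA), ← Finset.prod_pow_eq_pow_sum]
    _ = ∏ i ∈ t, (x i + y i) := (Finset.prod_add _ _ _).symm
    _ ≤ ∏ i ∈ t, ((2 * s₂ + 2 * C) ^ (W i).card *
          (n : ℝ) ^ ((1 : ℤ) - ((W i).card : ℤ))) := by
        refine Finset.prod_le_prod (fun i _ => by positivity) fun i hi => ?_
        have hc : (W i).card ≠ 0 := (Finset.card_pos.2 (hW0 i hi)).ne'
        have hz : (0 : ℝ) ≤ (n : ℝ) ^ ((1 : ℤ) - ((W i).card : ℤ)) := by positivity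
        have hx : x i ≤ (2 * s₂ : ℝ) ^ (W i).card *
            (n : ℝ) ^ ((1 : ℤ) - ((W i).card : ℤ)) := by
          simp only [x]
          rw [div_pow, div_eq_mul_inv, ← zpow_natCast (n : ℝ), ← zpow_neg]
          exact mul_le_mul_of_nonneg_left (zpow_le_zpow_right₀ hn1 (by omega)) (by positivity)
        have hy : y i ≤ (2 * C) ^ (W i).card * (n : ℝ) ^ ((1 : ℤ) - ((W i).card : ℤ)) :=
          mul_le_mul_of_nonneg_right (le_self_pow₀ (by linarith) hc) hz
        calc x i + y i ≤ ((2 * s₂ : ℝ) ^ (W i).card + (2 * C) ^ (W i).card) *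
              (n : ℝ) ^ ((1 : ℤ) - ((W i).card : ℤ)) := by rw [add_mul]; exact add_le_add hx hy
          _ ≤ _ := mul_le_mul_of_nonneg_right
              (pow_add_pow_le (by positivity) (by positivity) hc) hz
    _ = _ := by
        rw [Finset.prod_mul_distrib, Finset.prod_pow_eq_pow_sum, hdisj t subset_rfl]
        congr 1
        rw [prod_zpow_eq_zpow_sum t hn', Finset.sum_sub_distrib]
        simp

open Classical in
/-- The edge sets of the components of `I`. -/
noncomputable def componentsF {n : ℕ} (I : Finset (Finset (Fin n))) :
    Finset (Finset (Finset (Fin n))) :=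
  I.image (fun e => I.filter (fun f =>
    Relation.ReflTransGen (fun a b => a ∈ I ∧ b ∈ I ∧ ∃ v, v ∈ a ∧ v ∈ b) e f))

lemma disjoint_vertsF_of_mem_componentsF {n : ℕ} {I : Finset (Finset (Fin n))}
    {D E : Finset (Finset (Fin n))} (hD : D ∈ componentsF I) (hE : E ∈ componentsF I)
    (hDE : D ≠ E) : Disjoint (vertsF D) (vertsF E) := by
  classical
  rw [Finset.disjoint_left]
  intro v hvD hvE
  obtain ⟨d, _, rfl⟩ := Finset.mem_image.1 hD
  obtain ⟨e, _, rfl⟩ := Finset.mem_image.1 hE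
  obtain ⟨a, ha, hva⟩ := Finset.mem_biUnion.1 hvD
  obtain ⟨b, hb, hvb⟩ := Finset.mem_biUnion.1 hvE
  rw [Finset.mem_filter] at ha hb
  set r : Finset (Fin n) → Finset (Fin n) → Prop :=
    fun a b => a ∈ I ∧ b ∈ I ∧ ∃ v, v ∈ a ∧ v ∈ b with hr
  have hsymm : ∀ {p q}, Relation.ReflTransGen r p q → Relation.ReflTransGen r q p := by
    intro p q h
    induction h with
    | refl => exact .refl
    | tail _ h ih => exact .head ⟨h.2.1, h.1, h.2.2.imp fun _ h => h.symm⟩ ih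
  have hde : Relation.ReflTransGen r d e :=
    (ha.2.tail ⟨ha.1, hb.1, v, hva, hvb⟩).trans (hsymm hb.2)
  refine hDE (Finset.filter_congr fun f _ => ⟨fun h => (hsymm hde).trans h, fun h => hde.trans h⟩)

lemma biUnion_vertsF_componentsF {n : ℕ} (I : Finset (Finset (Fin n))) :
    (componentsF I).biUnion vertsF = vertsF I := by
  classical
  ext v
  simp only [vertsF, componentsF, Finset.mem_biUnion, Finset.mem_image, id]
  constructor
  · rintro ⟨_, ⟨e, _, rfl⟩, f, hf, hv⟩
    exact ⟨f, (Finset.mem_filter.1 hf).1, hv⟩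
  · rintro ⟨e, he, hv⟩
    exact ⟨_, ⟨e, he, rfl⟩, e, Finset.mem_filter.2 ⟨he, .refl⟩, hv⟩

lemma vertsF_nonempty_of_mem_componentsF {n : ℕ} {I : Finset (Finset (Fin n))}
    (hI : ∀ e ∈ I, e.Nonempty) {D : Finset (Finset (Fin n))} (hD : D ∈ componentsF I) :
    (vertsF D).Nonempty := by
  classical
  obtain ⟨e, he, rfl⟩ := Finset.mem_image.1 hD
  obtain ⟨v, hv⟩ := hI e he
  exact ⟨v, Finset.mem_biUnion.2 ⟨e, Finset.mem_filter.2 ⟨he, .refl⟩, hv⟩⟩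

/-- A component each of whose edges lies in one of some pairwise disjoint sets lies in a single
one of them. -/
lemma exists_vertsF_subset_of_mem_componentsF {n : ℕ} {I : Finset (Finset (Fin n))}
    {D : Finset (Finset (Fin n))} (hD : D ∈ componentsF I) (T : Set (Finset (Fin n)))
    (hT : T.PairwiseDisjoint id) (hIT : ∀ e ∈ I, ∃ Y ∈ T, e ⊆ Y) :
    ∃ Y ∈ T, vertsF D ⊆ Y := by
  classical
  obtain ⟨e, he, rfl⟩ := Finset.mem_image.1 hD
  obtain ⟨Y, hY, heY⟩ := hIT e he
  refine ⟨Y, hY, Finset.biUnion_subset.2 fun f hf => ?_⟩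
  have h := (Finset.mem_filter.1 hf).2
  simp only [id]
  clear hf
  induction h with
  | refl => exact heY
  | tail _ hbc ih =>
    obtain ⟨_, hc, v, hvb, hvc⟩ := hbc
    obtain ⟨Z, hZ, hcZ⟩ := hIT _ hc
    have : Y = Z := by
      by_contra hne
      exact Finset.disjoint_left.1 (hT hY hZ hne) (ih hvb) (hcZ hvc)
    exact this ▸ hcZ

/-- **Spread matchings with an exceptional clique.**  Pick an `s₂`-set `X`
according to `μ₂` and then a perfect matching `M` of `P - X` according to a
`(C n^{-s₁+1})`-spread distribution `ν X`; the resulting random `2`-graph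
`R = ∂₂(X ∪ M)` contains every `2`-graph `I` with `v` vertices and `c ≤ n/2`
components with probability at most `K^v n^{c-v}`. -/
theorem spread_matching_correct_two
    (C : ℝ) (hC : 1 ≤ C) (s₂ : ℕ) (hs₂ : 1 ≤ s₂) :
    ∃ K : ℝ, 0 < K ∧
      ∀ n m s₁ : ℕ, 0 < s₁ → 0 < m → n = s₂ + s₁ * m →
      ∀ P : Finset (Finset (Fin n)), IsHG s₁ n P →
      ∀ ν : Finset (Fin n) → Finset (Finset (Fin n)) → ℝ,
        (∀ X : Finset (Fin n), X.card = s₂ →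
          IsPMDist (Finset.univ \ X) P (ν X) ∧
          IsSpreadPM P (C * (n : ℝ) ^ ((1 : ℤ) - (s₁ : ℤ))) (ν X)) →
      ∀ μ₂ : Finset (Fin n) → ℝ,
        (∀ X, 0 ≤ μ₂ X) → (∀ X, μ₂ X ≠ 0 → X.card = s₂) →
        (∑ X : Finset (Fin n), μ₂ X) = 1 →
        (∀ X' : Finset (Fin n), X'.card = s₂ → μ₂ X' ≤ 2 / ((n.choose s₂ : ℕ) : ℝ)) →
      ∀ I : Finset (Finset (Fin n)), (∀ e ∈ I, e.card = 2) →
        (numCompsF I : ℝ) ≤ (n : ℝ) / 2 →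
        (∑ X : Finset (Fin n),
            μ₂ X * pmProb (ν X) (fun M => ∀ e ∈ I, e ⊆ X ∨ ∃ f ∈ M, e ⊆ f))
          ≤ K ^ (vertsF I).card *
            (n : ℝ) ^ ((numCompsF I : ℤ) - ((vertsF I).card : ℤ)) := by
  classical
  refine ⟨2 * s₂ + 2 * C, by positivity, ?_⟩
  intro n m s₁ hs₁ hm hnm P hP ν hν μ₂ hμ0 hμ hμ1 hμ' I hI hc
  have hcard : (componentsF I).card = numCompsF I := rfl
  have hsn : s₂ ≤ n := hnm ▸ Nat.le_add_right _ _
  have hcn : (componentsF I).card ≤ n := by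
    have h0 : (0 : ℝ) ≤ n := Nat.cast_nonneg n
    have : (numCompsF I : ℝ) ≤ n := by linarith
    exact_mod_cast this
  have key := sum_mul_pmProb_cover_le hC hs₂ hsn hP hν hμ0 hμ hμ1 hμ' vertsF (componentsF I)
    (fun D hD E hE => disjoint_vertsF_of_mem_componentsF hD hE)
    (fun D hD => vertsF_nonempty_of_mem_componentsF
      (fun e he => Finset.card_pos.1 (by rw [hI e he]; norm_num)) hD) hcn
  rw [biUnion_vertsF_componentsF, hcard] at key
  refine le_trans (Finset.sum_le_sum fun X _ => ?_) key
  by_cases h0 : μ₂ X = 0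
  · simp [h0]
  have hdist := (hν X (hμ X h0)).1
  refine mul_le_mul_of_nonneg_left ?_ (hμ0 X)
  refine (pmProb_le_sum hdist.1 {()} _ (fun _ M => ∀ D ∈ componentsF I,
    vertsF D ⊆ X ∨ ∃ e ∈ M, vertsF D ⊆ e) fun M hM h =>
      ⟨(), Finset.mem_singleton_self _, fun D hD => ?_⟩).trans_eq (Finset.sum_singleton _ _)
  obtain ⟨_, hMS, hMd, _⟩ := hdist.2.1 M hM
  have hXM : ∀ e ∈ M, Disjoint X e := fun e he =>
    Finset.disjoint_sdiff.mono_right (hMS e he)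
  obtain ⟨Y, hY, hDY⟩ := exists_vertsF_subset_of_mem_componentsF hD
    (insert X (M : Set (Finset (Fin n))))
    (by
      rintro e (rfl | he) f (rfl | hf) hef
      · exact absurd rfl hef
      · exact hXM f hf
      · exact (hXM e he).symm
      · exact hMd e he f hf hef)
    (fun e he => by
      rcases h e he with h | ⟨f, hf, hef⟩
      · exact ⟨X, Set.mem_insert _ _, h⟩
      · exact ⟨f, Set.mem_insert_of_mem _ hf, hef⟩)
  rcases hY with rfl | hY
  · exact Or.inl hDY
  · exact Or.inr ⟨Y, hY, hDY⟩
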